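/- arXiv:1505.02613 — 2 statements merged into one kernel-verified Lean document; each statement's English description precedes it below -/
import Mathlib

section
/- (Theorem 2) Let z = (z_1,...,z_p) be a random vector with independent standardized components having finite fourth moments, and write γ_k = E[z_k^3] and κ_k = E[z_k^4] − 3. Then for all nonnegative reals α_1, α_2 and every unit vector u ∈ ℝ^p (u^T u = 1), α_1 (E[(u^T z)^3])^2 + α_2 (E[(u^T z)^4] − 3)^2 ≤ max_{1 ≤ k ≤ p} (α_1 γ_k^2 + α_2 κ_k^2). (Note that for such u the linear combination u^T z has mean zero and unit variance, so E[(u^T z)^3] and E[(u^T z)^4] − 3 are its skewness and excess kurtosis.) -/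
open MeasureTheory ProbabilityTheory

section

variable {Ω : Type*} [MeasurableSpace Ω] {μ : Measure Ω}

lemma MeasureTheory.MemLp.integrable_pow_of_le_four [IsFiniteMeasure μ] {X : Ω → ℝ}
    (hX : MemLp X 4 μ) {n : ℕ} (hn : n ≤ 4) : Integrable (fun ω => X ω ^ n) μ := by
  have h : MemLp X n μ := hX.mono_exponent (by exact_mod_cast hn)
  refine (integrable_norm_iff (hX.1.pow n)).mp ?_
  simpa [norm_pow] using h.integrable_norm_pow'

lemma ProbabilityTheory.IndepFun.integral_pow_mul_pow {X Y : Ω → ℝ} (h : IndepFun X Y μ)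
    (hX : AEStronglyMeasurable X μ) (hY : AEStronglyMeasurable Y μ) (m n : ℕ) :
    ∫ ω, X ω ^ m * Y ω ^ n ∂μ = (∫ ω, X ω ^ m ∂μ) * ∫ ω, Y ω ^ n ∂μ :=
  (h.comp (φ := fun x => x ^ m) (ψ := fun x => x ^ n) (by fun_prop)
    (by fun_prop)).integral_fun_mul_eq_mul_integral (hX.pow m) (hY.pow n)

lemma ProbabilityTheory.IndepFun.integrable_pow_mul_pow [IsFiniteMeasure μ] {X Y : Ω → ℝ}
    (h : IndepFun X Y μ) (hX : MemLp X 4 μ) (hY : MemLp Y 4 μ) {m n : ℕ} (hm : m ≤ 4)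
    (hn : n ≤ 4) : Integrable (fun ω => X ω ^ m * Y ω ^ n) μ :=
  (h.comp (φ := fun x => x ^ m) (ψ := fun x => x ^ n) (by fun_prop)
    (by fun_prop)).integrable_mul (hX.integrable_pow_of_le_four hm)
    (hY.integrable_pow_of_le_four hn)

/-- Binomial expansion of the moments of a sum of two independent variables. -/
lemma ProbabilityTheory.IndepFun.integral_add_pow [IsFiniteMeasure μ] {X Y : Ω → ℝ}
    (h : IndepFun X Y μ) (hX : MemLp X 4 μ) (hY : MemLp Y 4 μ) {n : ℕ} (hn : n ≤ 4) :
    ∫ ω, (X ω + Y ω) ^ n ∂μ = ∑ m ∈ Finset.range (n + 1),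
      (∫ ω, X ω ^ m ∂μ) * (∫ ω, Y ω ^ (n - m) ∂μ) * (n.choose m : ℝ) := by
  simp_rw [add_pow]
  rw [integral_finsetSum]
  · refine Finset.sum_congr rfl fun m _ => ?_
    rw [integral_mul_const, h.integral_pow_mul_pow hX.1 hY.1]
  · intro m hm
    have := Finset.mem_range.mp hm
    exact (h.integrable_pow_mul_pow hX hY (by omega) (by omega)).mul_const _

/-- The first four moments of a linear combination of independent standardized variables. -/
lemma ProbabilityTheory.iIndepFun.moments_sum_mul [IsProbabilityMeasure μ] {ι : Type*}
    {z : ι → Ω → ℝ} (hindep : iIndepFun z μ)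
    (hmean : ∀ k, ∫ ω, z k ω ∂μ = 0) (hvar : ∀ k, ∫ ω, (z k ω) ^ 2 ∂μ = 1)
    (hmom : ∀ k, MemLp (z k) 4 μ) (u : ι → ℝ) (s : Finset ι) :
    ∫ ω, ∑ k ∈ s, u k * z k ω ∂μ = 0 ∧
    ∫ ω, (∑ k ∈ s, u k * z k ω) ^ 2 ∂μ = ∑ k ∈ s, u k ^ 2 ∧
    ∫ ω, (∑ k ∈ s, u k * z k ω) ^ 3 ∂μ = ∑ k ∈ s, u k ^ 3 * ∫ ω, z k ω ^ 3 ∂μ ∧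
    ∫ ω, (∑ k ∈ s, u k * z k ω) ^ 4 ∂μ =
      ∑ k ∈ s, u k ^ 4 * ((∫ ω, z k ω ^ 4 ∂μ) - 3) + 3 * (∑ k ∈ s, u k ^ 2) ^ 2 := by
  classical
  induction s using Finset.induction_on with
  | empty => simp
  | insert a s ha ih =>
    obtain ⟨h1, h2, h3, h4⟩ := ih
    have hL : ∀ k, MemLp (fun ω => u k * z k ω) 4 μ := fun k => (hmom k).const_mul (u k)
    have hS : MemLp (fun ω => ∑ k ∈ s, u k * z k ω) 4 μ := memLp_finsetSum s fun k _ => hL k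
    have hi : iIndepFun (fun k ω => u k * z k ω) μ :=
      hindep.comp (fun k x => u k * x) (fun k => by fun_prop)
    have hI : IndepFun (fun ω => u a * z a ω) (fun ω => ∑ k ∈ s, u k * z k ω) μ := by
      have := (hi.indepFun_finsetSum_of_notMem₀ (fun k => (hL k).1.aemeasurable) ha).symm
      simpa [Finset.sum_fn] using this
    have e := fun n (hn : n ≤ 4) => hI.integral_add_pow (hL a) hS hn
    have e1 := e 1 (by norm_num)
    have e2 := e 2 (by norm_num)
    have e3 := e 3 (by norm_num)
    have e4 := e 4 (by norm_num)
    simp only [Finset.sum_range_succ, Finset.range_zero, Finset.sum_empty, mul_pow,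
      integral_const_mul, pow_zero, pow_one, hmean, hvar, h2, h3, h4, Nat.choose] at e1 e2 e3 e4
    simp only [Finset.sum_insert ha]
    refine ⟨?_, ?_, ?_, ?_⟩
    · rw [e1]; simp [h1]
    · rw [e2]; simp [h1]; ring
    · rw [e3]; simp [h1]; ring
    · rw [e4]; simp [h1]; ring

end

/-- Jensen's inequality for the square, with weights `u k ^ 2` and damping by powers of `u k`. -/
lemma sq_sum_pow_mul_le {ι : Type*} (s : Finset ι) (u c : ι → ℝ) (hu : ∑ k ∈ s, u k ^ 2 = 1)
    (n : ℕ) : (∑ k ∈ s, u k ^ (n + 2) * c k) ^ 2 ≤ ∑ k ∈ s, u k ^ 2 * c k ^ 2 := by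
  calc (∑ k ∈ s, u k ^ (n + 2) * c k) ^ 2
      = (∑ k ∈ s, u k * (u k * (u k ^ n * c k))) ^ 2 := by
        congr 1; exact Finset.sum_congr rfl fun k _ => by ring
    _ ≤ (∑ k ∈ s, u k ^ 2) * ∑ k ∈ s, (u k * (u k ^ n * c k)) ^ 2 :=
        Finset.sum_mul_sq_le_sq_mul_sq s _ _
    _ = ∑ k ∈ s, u k ^ 2 * ((u k ^ 2) ^ n * c k ^ 2) := by
        rw [hu, one_mul]
        exact Finset.sum_congr rfl fun k _ => by ring
    _ ≤ ∑ k ∈ s, u k ^ 2 * c k ^ 2 := by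
        gcongr with k hk
        have h : u k ^ 2 ≤ 1 :=
          hu ▸ Finset.single_le_sum (f := fun k => u k ^ 2) (fun i _ => sq_nonneg (u i)) hk
        exact mul_le_of_le_one_left (sq_nonneg _) (pow_le_one₀ (sq_nonneg _) h)

/-- Theorem 2: Let `z = (z_1,...,z_p)` have independent standardized
components with finite fourth moments, `γ_k = E[z_k^3]`, `κ_k = E[z_k^4] - 3`. Then for all
nonnegative reals `α₁, α₂` and every unit vector `u`,
`α₁ (E[(uᵀz)^3])^2 + α₂ (E[(uᵀz)^4] - 3)^2 ≤ max_k (α₁ γ_k^2 + α₂ κ_k^2)`. -/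
theorem weighted_squared_cumulants_le_max
    {Ω : Type*} [MeasurableSpace Ω] (μ : Measure Ω) [IsProbabilityMeasure μ]
    (p : ℕ) (hp : 0 < p) (z : Fin p → Ω → ℝ)
    (hindep : iIndepFun z μ)
    (hmean : ∀ k, ∫ ω, z k ω ∂μ = 0)
    (hvar : ∀ k, ∫ ω, (z k ω) ^ 2 ∂μ = 1)
    (hmom : ∀ k, MemLp (z k) 4 μ)
    (γ : Fin p → ℝ) (hγ : ∀ k, γ k = ∫ ω, (z k ω) ^ 3 ∂μ)
    (κ : Fin p → ℝ) (hκ : ∀ k, κ k = (∫ ω, (z k ω) ^ 4 ∂μ) - 3)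
    (α₁ α₂ : ℝ) (hα₁ : 0 ≤ α₁) (hα₂ : 0 ≤ α₂)
    (u : Fin p → ℝ) (hu : ∑ k, (u k) ^ 2 = 1) :
    α₁ * (∫ ω, (∑ k, u k * z k ω) ^ 3 ∂μ) ^ 2
      + α₂ * ((∫ ω, (∑ k, u k * z k ω) ^ 4 ∂μ) - 3) ^ 2
    ≤ Finset.univ.sup' (Finset.univ_nonempty_iff.mpr ⟨⟨0, hp⟩⟩)
        (fun k => α₁ * (γ k) ^ 2 + α₂ * (κ k) ^ 2) := by
  obtain ⟨-, -, h3, h4⟩ := hindep.moments_sum_mul hmean hvar hmom u Finset.univ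
  have h3' : ∫ ω, (∑ k, u k * z k ω) ^ 3 ∂μ = ∑ k, u k ^ 3 * γ k := by simp_rw [h3, hγ]
  have h4' : (∫ ω, (∑ k, u k * z k ω) ^ 4 ∂μ) - 3 = ∑ k, u k ^ 4 * κ k := by
    simp_rw [h4, hκ, hu]; ring
  rw [h3', h4']
  set M := Finset.univ.sup' (Finset.univ_nonempty_iff.mpr ⟨⟨0, hp⟩⟩)
    (fun k => α₁ * (γ k) ^ 2 + α₂ * (κ k) ^ 2)
  calc α₁ * (∑ k, u k ^ 3 * γ k) ^ 2 + α₂ * (∑ k, u k ^ 4 * κ k) ^ 2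
      ≤ α₁ * ∑ k, u k ^ 2 * γ k ^ 2 + α₂ * ∑ k, u k ^ 2 * κ k ^ 2 := by
        gcongr
        · exact sq_sum_pow_mul_le _ u γ hu 1
        · exact sq_sum_pow_mul_le _ u κ hu 2
    _ = ∑ k, u k ^ 2 * (α₁ * γ k ^ 2 + α₂ * κ k ^ 2) := by
        rw [Finset.mul_sum, Finset.mul_sum, ← Finset.sum_add_distrib]
        exact Finset.sum_congr rfl fun k _ => by ring
    _ ≤ ∑ k, u k ^ 2 * M := by
        gcongr with k
        exact Finset.le_sup' (fun k => α₁ * (γ k) ^ 2 + α₂ * (κ k) ^ 2) (Finset.mem_univ k)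
    _ = M := by rw [← Finset.sum_mul, hu, one_mul]
end

section
/- (Theorem 5) Let z = (z_1,...,z_p) be a random vector with independent standardized components having finite fourth moments, and let U be a p × p orthogonal matrix. Then each of the symmetric matrices C^{3i}(Uz) (i = 1,...,p), C^{4ij}(Uz) (i,j = 1,...,p), C^3(Uz) = ∑_i C^{3i}(Uz) and C^4(Uz) = ∑_i C^{4ii}(Uz) can be written as U D U^T for some diagonal matrix D (depending on the matrix); in particular, the columns of U are eigenvectors of each of these matrices. -/
open MeasureTheory ProbabilityTheory Matrix

/-- The third cumulant matrix `C^{3i}(x) = E[x_i · x xᵀ]` of a centered random vector. -/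
noncomputable def thirdCumulantMatrix {Ω : Type*} [MeasurableSpace Ω] (μ : Measure Ω)
    {p : ℕ} (x : Fin p → Ω → ℝ) (i : Fin p) : Matrix (Fin p) (Fin p) ℝ :=
  Matrix.of fun k l => ∫ ω, x i ω * x k ω * x l ω ∂μ

/-- The fourth cumulant matrix `C^{4ij}(x)` of a centered random vector. -/
noncomputable def fourthCumulantMatrix {Ω : Type*} [MeasurableSpace Ω] (μ : Measure Ω)
    {p : ℕ} (x : Fin p → Ω → ℝ) (i j : Fin p) : Matrix (Fin p) (Fin p) ℝ :=
  Matrix.of fun k l =>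
    (∫ ω, x i ω * x j ω * (x k ω * x l ω) ∂μ)
      - (∫ ω, x i ω * x j ω ∂μ) * (∫ ω, x k ω * x l ω ∂μ)
      - (∫ ω, x i ω * x k ω ∂μ) * (∫ ω, x j ω * x l ω ∂μ)
      - (∫ ω, x j ω * x k ω ∂μ) * (∫ ω, x i ω * x l ω ∂μ)

instance ENNReal.holderTriple_four_four_two : ENNReal.HolderTriple 4 4 2 where
  inv_add_inv_eq_inv := by
    have h : (4 : ENNReal) = 2 * 2 := by norm_num
    rw [h, ENNReal.mul_inv (by simp) (by simp), ← mul_add, ENNReal.inv_two_add_inv_two, mul_one]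

section Moments

variable {Ω ι : Type*} [MeasurableSpace Ω] {μ : Measure Ω} {z : ι → Ω → ℝ}

lemma integrable_mul_mul_mul_of_memLp_four (hmom : ∀ k, MemLp (z k) 4 μ) (a b c d : ι) :
    Integrable (fun ω => z a ω * z b ω * (z c ω * z d ω)) μ :=
  (((hmom b).mul' (hmom a) : MemLp (fun ω => z a ω * z b ω) 2 μ)).integrable_mul
    ((hmom d).mul' (hmom c) : MemLp (fun ω => z c ω * z d ω) 2 μ)

lemma integrable_mul_mul_of_memLp_four [IsFiniteMeasure μ] (hmom : ∀ k, MemLp (z k) 4 μ)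
    (a b c : ι) : Integrable (fun ω => z a ω * z b ω * z c ω) μ :=
  (((hmom b).mul' (hmom a) : MemLp (fun ω => z a ω * z b ω) 2 μ)).integrable_mul
    ((hmom c).mono_exponent (by norm_num) : MemLp (z c) 2 μ)

lemma integrable_mul_of_memLp_four [IsFiniteMeasure μ] (hmom : ∀ k, MemLp (z k) 4 μ)
    (a b : ι) : Integrable (fun ω => z a ω * z b ω) μ :=
  ((hmom b).mul' (hmom a) : MemLp (fun ω => z a ω * z b ω) 2 μ).integrable (by norm_num)

/-- A centered variable is uncorrelated with any function of the other members of an independent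
family. -/
lemma ProbabilityTheory.iIndepFun.integral_mul_comp_eq_zero (hindep : iIndepFun z μ)
    (hz : ∀ k, AEMeasurable (z k) μ) {a : ι} (ha : ∫ ω, z a ω ∂μ = 0) {T : Finset ι} (haT : a ∉ T)
    {g : (T → ℝ) → ℝ} (hg : Measurable g) :
    ∫ ω, z a ω * g (fun i => z i ω) ∂μ = 0 := by
  have h := hindep.indepFun_finset₀ {a} T (by simpa using haT) hz
  have h' : IndepFun (z a) (fun ω => g fun i : T => z i ω) μ :=
    h.comp (φ := fun v : ({a} : Finset ι) → ℝ => v ⟨a, by simp⟩) (ψ := g) (by fun_prop) hg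
  have hT : AEMeasurable (fun ω => g fun i : T => z i ω) μ :=
    hg.comp_aemeasurable (aemeasurable_pi_lambda _ fun i => hz i)
  rw [h'.integral_fun_mul_eq_mul_integral (hz a).aestronglyMeasurable hT.aestronglyMeasurable, ha,
    zero_mul]

section Decidable

variable [DecidableEq ι]

lemma integral_mul_eq_ite (hindep : iIndepFun z μ) (hz : ∀ k, AEMeasurable (z k) μ)
    (hmean : ∀ k, ∫ ω, z k ω ∂μ = 0) (hvar : ∀ k, ∫ ω, (z k ω) ^ 2 ∂μ = 1) (a b : ι) :
    ∫ ω, z a ω * z b ω ∂μ = if a = b then 1 else 0 := by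
  split_ifs with h
  · subst h
    simpa only [pow_two] using hvar a
  · exact hindep.integral_mul_comp_eq_zero hz (hmean a) (T := {b}) (by simpa using h)
      (g := fun v => v ⟨b, by simp⟩) (by fun_prop)

lemma integral_mul_mul_eq_ite (hindep : iIndepFun z μ) (hz : ∀ k, AEMeasurable (z k) μ)
    (hmean : ∀ k, ∫ ω, z k ω ∂μ = 0) (a b c : ι) :
    ∫ ω, z a ω * z b ω * z c ω ∂μ = if a = b ∧ a = c then ∫ ω, (z a ω) ^ 3 ∂μ else 0 := by
  have key : ∀ a b c, a ≠ b → a ≠ c → ∫ ω, z a ω * (z b ω * z c ω) ∂μ = 0 := fun a b c hb hc =>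
    hindep.integral_mul_comp_eq_zero hz (hmean a) (T := {b, c}) (by simp [hb, hc])
      (g := fun v => v ⟨b, by simp⟩ * v ⟨c, by simp⟩) (by fun_prop)
  split_ifs with h
  · obtain ⟨rfl, rfl⟩ := h
    simp only [pow_succ, pow_zero, one_mul]
  · by_cases hab : a = b
    · subst hab
      have hac : c ≠ a := fun hc => h ⟨rfl, hc.symm⟩
      rw [← key c a a hac hac]
      exact integral_congr_ae (.of_forall fun ω => by ring)
    · by_cases hac : a = c
      · subst hac
        rw [← key b a a (Ne.symm hab) (Ne.symm hab)]
        exact integral_congr_ae (.of_forall fun ω => by ring)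
      · simpa only [mul_assoc] using key a b c hab hac

lemma integral_mul_mul_mul_eq_ite (hindep : iIndepFun z μ) (hz : ∀ k, AEMeasurable (z k) μ)
    (hmean : ∀ k, ∫ ω, z k ω ∂μ = 0) (hvar : ∀ k, ∫ ω, (z k ω) ^ 2 ∂μ = 1) (a b c d : ι) :
    ∫ ω, z a ω * z b ω * (z c ω * z d ω) ∂μ =
      (if a = b then 1 else 0) * (if c = d then 1 else 0)
      + (if a = c then 1 else 0) * (if b = d then 1 else 0)
      + (if b = c then 1 else 0) * (if a = d then 1 else 0)
      + (if a = b then 1 else 0) * ((if a = c then 1 else 0) * (if a = d then 1 else 0))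
        * (∫ ω, (z a ω) ^ 4 ∂μ - 3) := by
  set M : ι → ι → ι → ι → ℝ := fun a b c d => ∫ ω, z a ω * z b ω * (z c ω * z d ω) ∂μ with hM
  have isolated : ∀ a b c d, a ≠ b → a ≠ c → a ≠ d → M a b c d = 0 := by
    intro a b c d hb hc hd
    simp only [hM, mul_assoc]
    exact hindep.integral_mul_comp_eq_zero hz (hmean a) (T := {b, c, d}) (by simp [hb, hc, hd])
      (g := fun v => v ⟨b, by simp⟩ * (v ⟨c, by simp⟩ * v ⟨d, by simp⟩)) (by fun_prop)
  have pairs : ∀ a c, a ≠ c → M a a c c = 1 := by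
    intro a c hac
    have h : IndepFun (fun ω => z a ω * z a ω) (fun ω => z c ω * z c ω) μ :=
      (hindep.indepFun hac).comp (φ := fun t => t * t) (ψ := fun t => t * t)
        (by fun_prop) (by fun_prop)
    simp only [hM]
    rw [h.integral_fun_mul_eq_mul_integral ((hz a).mul (hz a)).aestronglyMeasurable
      ((hz c).mul (hz c)).aestronglyMeasurable]
    simpa only [pow_two, one_mul, hvar] using congrArg₂ (· * ·) (hvar a) (hvar c)
  have swap₁₂ : ∀ a b c d, M a b c d = M b a c d := fun a b c d =>
    integral_congr_ae (.of_forall fun ω => by ring)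
  have swap₁₃ : ∀ a b c d, M a b c d = M c b a d := fun a b c d =>
    integral_congr_ae (.of_forall fun ω => by ring)
  have swap₁₄ : ∀ a b c d, M a b c d = M d b c a := fun a b c d =>
    integral_congr_ae (.of_forall fun ω => by ring)
  have diag : ∀ a, M a a a a = ∫ ω, (z a ω) ^ 4 ∂μ := fun a =>
    integral_congr_ae (.of_forall fun ω => by ring)
  change M a b c d = _
  have h₁ := isolated a b c d
  have h₂ := isolated b a c d
  have h₃ := isolated c b a d
  have h₄ := isolated d b c a
  rw [← swap₁₂] at h₂
  rw [← swap₁₃] at h₃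
  rw [← swap₁₄] at h₄
  by_cases hab : a = b
  · subst hab
    by_cases hcd : c = d
    · subst hcd
      by_cases hac : a = c
      · subst hac
        simp only [diag, if_true]
        ring
      · simp [pairs a c hac, hac]
    · grind
  · by_cases hac : a = c
    · subst hac
      by_cases hbd : b = d
      · subst hbd
        rw [swap₁₄, swap₁₂, swap₁₄, swap₁₃, swap₁₄]
        simp [pairs, hab, Ne.symm hab]
      · grind
    · by_cases had : a = d
      · subst had
        by_cases hbc : b = c
        · subst hbc
          rw [swap₁₃, swap₁₂]
          simp [pairs, hab, Ne.symm hab]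
        · grind
      · grind

end Decidable

variable [Fintype ι]

lemma integral_linearComb_mul [IsFiniteMeasure μ] (hmom : ∀ k, MemLp (z k) 4 μ) (s t : ι → ℝ) :
    ∫ ω, (∑ k, s k * z k ω) * (∑ k, t k * z k ω) ∂μ =
      ∑ a, ∑ b, s a * t b * ∫ ω, z a ω * z b ω ∂μ := by
  have hint := integrable_mul_of_memLp_four hmom
  calc
    _ = ∫ ω, ∑ a, ∑ b, s a * t b * (z a ω * z b ω) ∂μ := by
      refine integral_congr_ae (.of_forall fun ω => ?_)
      simp only [Finset.sum_mul_sum, mul_mul_mul_comm]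
    _ = _ := by
      rw [integral_finsetSum _ fun a _ => integrable_finsetSum _ fun b _ =>
        (hint a b).const_mul _]
      refine Finset.sum_congr rfl fun a _ => ?_
      rw [integral_finsetSum _ fun b _ => (hint a b).const_mul _]
      simp only [integral_const_mul]

lemma integral_linearComb_mul_mul [IsFiniteMeasure μ] (hmom : ∀ k, MemLp (z k) 4 μ)
    (s t u : ι → ℝ) :
    ∫ ω, (∑ k, s k * z k ω) * (∑ k, t k * z k ω) * (∑ k, u k * z k ω) ∂μ =
      ∑ a, ∑ b, ∑ c, s a * t b * u c * ∫ ω, z a ω * z b ω * z c ω ∂μ := by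
  have hint := integrable_mul_mul_of_memLp_four hmom
  calc
    _ = ∫ ω, ∑ a, ∑ b, ∑ c, s a * t b * u c * (z a ω * z b ω * z c ω) ∂μ := by
      refine integral_congr_ae (.of_forall fun ω => ?_)
      beta_reduce
      rw [Finset.sum_mul_sum]
      simp only [Finset.sum_mul]
      simp only [Finset.mul_sum]
      exact Finset.sum_congr rfl fun a _ => Finset.sum_congr rfl fun b _ =>
        Finset.sum_congr rfl fun c _ => by ring
    _ = _ := by
      rw [integral_finsetSum _ fun a _ => integrable_finsetSum _ fun b _ =>
        integrable_finsetSum _ fun c _ => (hint a b c).const_mul _]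
      refine Finset.sum_congr rfl fun a _ => ?_
      rw [integral_finsetSum _ fun b _ => integrable_finsetSum _ fun c _ =>
        (hint a b c).const_mul _]
      refine Finset.sum_congr rfl fun b _ => ?_
      rw [integral_finsetSum _ fun c _ => (hint a b c).const_mul _]
      simp only [integral_const_mul]

lemma integral_linearComb_mul_mul_mul (hmom : ∀ k, MemLp (z k) 4 μ) (s t u v : ι → ℝ) :
    ∫ ω, (∑ k, s k * z k ω) * (∑ k, t k * z k ω) *
        ((∑ k, u k * z k ω) * (∑ k, v k * z k ω)) ∂μ =
      ∑ a, ∑ b, ∑ c, ∑ d,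
        s a * t b * (u c * v d) * ∫ ω, z a ω * z b ω * (z c ω * z d ω) ∂μ := by
  have hint := integrable_mul_mul_mul_of_memLp_four hmom
  calc
    _ = ∫ ω, ∑ a, ∑ b, ∑ c, ∑ d,
        s a * t b * (u c * v d) * (z a ω * z b ω * (z c ω * z d ω)) ∂μ := by
      refine integral_congr_ae (.of_forall fun ω => ?_)
      beta_reduce
      rw [Finset.sum_mul_sum, Finset.sum_mul_sum]
      simp only [Finset.sum_mul]
      simp only [Finset.mul_sum]
      exact Finset.sum_congr rfl fun a _ => Finset.sum_congr rfl fun b _ =>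
        Finset.sum_congr rfl fun c _ => Finset.sum_congr rfl fun d _ => by ring
    _ = _ := by
      rw [integral_finsetSum _ fun a _ => integrable_finsetSum _ fun b _ =>
        integrable_finsetSum _ fun c _ => integrable_finsetSum _ fun d _ =>
          (hint a b c d).const_mul _]
      refine Finset.sum_congr rfl fun a _ => ?_
      rw [integral_finsetSum _ fun b _ => integrable_finsetSum _ fun c _ =>
        integrable_finsetSum _ fun d _ => (hint a b c d).const_mul _]
      refine Finset.sum_congr rfl fun b _ => ?_
      rw [integral_finsetSum _ fun c _ => integrable_finsetSum _ fun d _ =>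
        (hint a b c d).const_mul _]
      refine Finset.sum_congr rfl fun c _ => ?_
      rw [integral_finsetSum _ fun d _ => (hint a b c d).const_mul _]
      simp only [integral_const_mul]

end Moments

section CumulantMatrices

variable {Ω : Type*} [MeasurableSpace Ω] {μ : Measure Ω} [IsProbabilityMeasure μ]
  {p : ℕ} {z : Fin p → Ω → ℝ}

theorem thirdCumulantMatrix_linear (hindep : iIndepFun z μ)
    (hmean : ∀ k, ∫ ω, z k ω ∂μ = 0) (hmom : ∀ k, MemLp (z k) 4 μ)
    (U : Matrix (Fin p) (Fin p) ℝ) (i : Fin p) :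
    thirdCumulantMatrix μ (fun j ω => ∑ k, U j k * z k ω) i =
      U * diagonal (fun a => U i a * ∫ ω, (z a ω) ^ 3 ∂μ) * Uᵀ := by
  ext k l
  rw [mul_apply]
  simp only [thirdCumulantMatrix, of_apply, integral_linearComb_mul_mul hmom,
    integral_mul_mul_eq_ite hindep (fun k => (hmom k).aemeasurable) hmean,
    mul_diagonal, transpose_apply, ite_and, mul_ite, mul_zero, Finset.sum_ite_irrel,
    Finset.sum_ite_eq, Finset.mem_univ, if_true, Finset.sum_const_zero]
  exact Finset.sum_congr rfl fun a _ => by ring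

theorem fourthCumulantMatrix_linear (hindep : iIndepFun z μ)
    (hmean : ∀ k, ∫ ω, z k ω ∂μ = 0) (hvar : ∀ k, ∫ ω, (z k ω) ^ 2 ∂μ = 1)
    (hmom : ∀ k, MemLp (z k) 4 μ) (U : Matrix (Fin p) (Fin p) ℝ) (i j : Fin p) :
    fourthCumulantMatrix μ (fun j ω => ∑ k, U j k * z k ω) i j =
      U * diagonal (fun a => U i a * U j a * (∫ ω, (z a ω) ^ 4 ∂μ - 3)) * Uᵀ := by
  have hz : ∀ k, AEMeasurable (z k) μ := fun k => (hmom k).aemeasurable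
  have hcov : ∀ s t : Fin p → ℝ,
      ∫ ω, (∑ k, s k * z k ω) * (∑ k, t k * z k ω) ∂μ = ∑ a, s a * t a := by
    intro s t
    simp [integral_linearComb_mul hmom, integral_mul_eq_ite hindep hz hmean hvar]
  ext k l
  rw [mul_apply]
  simp only [fourthCumulantMatrix, of_apply, hcov, integral_linearComb_mul_mul_mul hmom,
    integral_mul_mul_mul_eq_ite hindep hz hmean hvar, mul_diagonal, transpose_apply,
    mul_add, Finset.sum_add_distrib]
  have e₁ : ∑ a, ∑ b, ∑ c, ∑ d, U i a * U j b * (U k c * U l d) *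
      ((if a = b then 1 else 0) * (if c = d then 1 else 0)) =
      (∑ a, U i a * U j a) * ∑ c, U k c * U l c := by
    simp [Finset.sum_mul_sum, Finset.sum_ite_irrel]
  have e₂ : ∑ a, ∑ b, ∑ c, ∑ d, U i a * U j b * (U k c * U l d) *
      ((if a = c then 1 else 0) * (if b = d then 1 else 0)) =
      (∑ a, U i a * U k a) * ∑ b, U j b * U l b := by
    simp [Finset.sum_mul_sum, mul_mul_mul_comm]
  have e₃ : ∑ a, ∑ b, ∑ c, ∑ d, U i a * U j b * (U k c * U l d) *
      ((if b = c then 1 else 0) * (if a = d then 1 else 0)) =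
      (∑ b, U j b * U k b) * ∑ a, U i a * U l a := by
    rw [mul_comm (∑ b, U j b * U k b)]
    simp only [Finset.sum_mul_sum, mul_ite, mul_one, mul_zero, Finset.sum_ite_eq,
      Finset.mem_univ, if_true]
    exact Finset.sum_congr rfl fun a _ => Finset.sum_congr rfl fun b _ => by ring
  have e₄ : ∑ a, ∑ b, ∑ c, ∑ d, U i a * U j b * (U k c * U l d) *
      ((if a = b then 1 else 0) * ((if a = c then 1 else 0) * (if a = d then 1 else 0))
        * (∫ ω, (z a ω) ^ 4 ∂μ - 3)) =
      ∑ a, U k a * (U i a * U j a * (∫ ω, (z a ω) ^ 4 ∂μ - 3)) * U l a := by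
    simp only [mul_ite, ite_mul, mul_one, one_mul, mul_zero, zero_mul,
      Finset.sum_ite_eq, Finset.mem_univ, if_true]
    exact Finset.sum_congr rfl fun a _ => by ring
  rw [e₁, e₂, e₃, e₄]
  ring

end CumulantMatrices

/-- Theorem 5: Let `z` have independent standardized components with finite
fourth moments and let `U` be orthogonal. Then each of `C^{3i}(Uz)`, `C^{4ij}(Uz)`,
`C^3(Uz) = ∑_i C^{3i}(Uz)` and `C^4(Uz) = ∑_i C^{4ii}(Uz)` can be written as `U D Uᵀ` for
some diagonal matrix `D`; in particular the columns of `U` are eigenvectors of each. -/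
theorem cumulant_matrices_diagonalized_by_U
    {Ω : Type*} [MeasurableSpace Ω] (μ : Measure Ω) [IsProbabilityMeasure μ]
    (p : ℕ) (z : Fin p → Ω → ℝ)
    (hindep : iIndepFun z μ)
    (hmean : ∀ k, ∫ ω, z k ω ∂μ = 0)
    (hvar : ∀ k, ∫ ω, (z k ω) ^ 2 ∂μ = 1)
    (hmom : ∀ k, MemLp (z k) 4 μ)
    (U : Matrix (Fin p) (Fin p) ℝ) (hU : U * Uᵀ = 1) :
    (∀ i, ∃ D : Matrix (Fin p) (Fin p) ℝ, D.IsDiag ∧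
        thirdCumulantMatrix μ (fun j ω => ∑ k, U j k * z k ω) i = U * D * Uᵀ) ∧
    (∀ i j, ∃ D : Matrix (Fin p) (Fin p) ℝ, D.IsDiag ∧
        fourthCumulantMatrix μ (fun j ω => ∑ k, U j k * z k ω) i j = U * D * Uᵀ) ∧
    (∃ D : Matrix (Fin p) (Fin p) ℝ, D.IsDiag ∧
        ∑ i, thirdCumulantMatrix μ (fun j ω => ∑ k, U j k * z k ω) i = U * D * Uᵀ) ∧
    (∃ D : Matrix (Fin p) (Fin p) ℝ, D.IsDiag ∧
        ∑ i, fourthCumulantMatrix μ (fun j ω => ∑ k, U j k * z k ω) i i = U * D * Uᵀ) := by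
  have h₃ := thirdCumulantMatrix_linear hindep hmean hmom U
  have h₄ := fourthCumulantMatrix_linear hindep hmean hvar hmom U
  refine ⟨fun i => ⟨_, isDiag_diagonal _, h₃ i⟩, fun i j => ⟨_, isDiag_diagonal _, h₄ i j⟩, ?_, ?_⟩
  · simp only [h₃, ← Finset.sum_mul, ← Finset.mul_sum]
    exact ⟨_, fun a b hab => by simp [Matrix.sum_apply, hab], rfl⟩
  · simp only [h₄, ← Finset.sum_mul, ← Finset.mul_sum]
    exact ⟨_, fun a b hab => by simp [Matrix.sum_apply, hab], rfl⟩
end
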